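/- arXiv:0912.4005 — 2 statements merged into one kernel-verified Lean document; each statement's English description precedes it below -/
import Mathlib

section
/- Let 𝔄 act trivially on 𝒜 from the left (via the functional f), and let J₀ be a closed ideal of 𝒜 with J ⊆ J₀. If the quotient algebra 𝒜/J₀ has a left identity e + J₀, then for every α ∈ 𝔄 and a ∈ 𝒜 one has a·α − f(α)a ∈ J₀. -/
noncomputable section

open scoped Topology

universe u u₁ u₂ u₃ v w

/-- The smallest closed two-sided ideal (realized as a `ℂ`-submodule which is topologically
closed and stable under multiplication by arbitrary elements) containing a given set. -/
def closedIdealGen {R : Type u} [NonUnitalNormedRing R] [NormedSpace ℂ R] (s : Set R) :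
    Submodule ℂ R :=
  sInf {p : Submodule ℂ R |
    s ⊆ (p : Set R) ∧ IsClosed (p : Set R) ∧ ∀ x ∈ p, ∀ y : R, x * y ∈ p ∧ y * x ∈ p}

/-- Data exhibiting the Banach space `TB` as the projective tensor product `B ⊗̂ B` of a
Banach algebra `B` with itself. -/
structure TensorSquareSetting (B : Type u) (TB : Type v)
    [NonUnitalNormedRing B] [NormedSpace ℂ B] [CompleteSpace B]
    [NonUnitalNormedRing TB] [NormedSpace ℂ TB] [CompleteSpace TB] where
  tp : B → B → TB
  tp_add_left : ∀ a b c, tp (a + b) c = tp a c + tp b c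
  tp_add_right : ∀ a b c, tp a (b + c) = tp a b + tp a c
  tp_smul_left : ∀ (z : ℂ) a b, tp (z • a) b = z • tp a b
  tp_smul_right : ∀ (z : ℂ) a b, tp a (z • b) = z • tp a b
  tp_norm : ∀ a b, ‖tp a b‖ ≤ ‖a‖ * ‖b‖
  tp_mul : ∀ a b c d, tp a b * tp c d = tp (a * c) (b * d)
  tp_dense :
    Dense ((Submodule.span ℂ (Set.range fun p : B × B => tp p.1 p.2) : Submodule ℂ TB) : Set TB)
  tp_universal : ∀ {X : Type w} [NormedAddCommGroup X] [NormedSpace ℂ X] [CompleteSpace X]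
      (φ : B →L[ℂ] B →L[ℂ] X),
      ∃ ψ : TB →L[ℂ] X, ‖ψ‖ ≤ ‖φ‖ ∧ ∀ a b, ψ (tp a b) = φ a b
  lmul : B → TB →L[ℂ] TB
  rmul : B → TB →L[ℂ] TB
  lmul_tp : ∀ a b c, lmul a (tp b c) = tp (a * b) c
  rmul_tp : ∀ a b c, rmul a (tp b c) = tp b (c * a)
  ω : TB →L[ℂ] B
  ω_tp : ∀ a b, ω (tp a b) = a * b

/-- A Banach algebra `B` is biprojective if the multiplication map
`ω : B ⊗̂ B → B` has a bounded right inverse which is a `B`-bimodule homomorphism. -/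
def TensorSquareSetting.Biprojective {B : Type u} {TB : Type v}
    [NonUnitalNormedRing B] [NormedSpace ℂ B] [CompleteSpace B]
    [NonUnitalNormedRing TB] [NormedSpace ℂ TB] [CompleteSpace TB]
    (ts : TensorSquareSetting B TB) : Prop :=
  ∃ ρ : B →L[ℂ] TB,
    (∀ a b, ρ (a * b) = ts.lmul a (ρ b)) ∧
    (∀ a b, ρ (b * a) = ts.rmul a (ρ b)) ∧
    (∀ a, ts.ω (ρ a) = a)

/-- A Banach algebra `B` is biflat if the adjoint `ω* : B* → (B ⊗̂ B)*` of the multiplication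
map has a bounded left inverse which is a `B`-bimodule homomorphism (for the dual actions
`a · f = f(· a)` and `f · a = f(a ·)`). -/
def TensorSquareSetting.Biflat {B : Type u} {TB : Type v}
    [NonUnitalNormedRing B] [NormedSpace ℂ B] [CompleteSpace B]
    [NonUnitalNormedRing TB] [NormedSpace ℂ TB] [CompleteSpace TB]
    [IsScalarTower ℂ B B] [SMulCommClass ℂ B B]
    (ts : TensorSquareSetting B TB) : Prop :=
  ∃ θ : (TB →L[ℂ] ℂ) →L[ℂ] (B →L[ℂ] ℂ),
    (∀ (a : B) (f : TB →L[ℂ] ℂ),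
      θ (f.comp (ts.rmul a)) = (θ f).comp ((ContinuousLinearMap.mul ℂ B).flip a)) ∧
    (∀ (a : B) (f : TB →L[ℂ] ℂ),
      θ (f.comp (ts.lmul a)) = (θ f).comp (ContinuousLinearMap.mul ℂ B a)) ∧
    (∀ g : B →L[ℂ] ℂ, θ (g.comp ts.ω) = g)

/-- Compatible bounded bimodule actions of a Banach algebra `𝔄` on a Banach algebra `𝒜`:
`lsmul α a = α · a` and `rsmul α a = a · α`, with `α · (a b) = (α · a) b` and
`(a b) · α = a (b · α)`. -/
structure ActionSetting (𝔄 : Type u₁) (𝒜 : Type u)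
    [NonUnitalNormedRing 𝔄] [NormedSpace ℂ 𝔄] [CompleteSpace 𝔄]
    [NonUnitalNormedRing 𝒜] [NormedSpace ℂ 𝒜] [CompleteSpace 𝒜] where
  lsmul : 𝔄 → 𝒜 →L[ℂ] 𝒜
  rsmul : 𝔄 → 𝒜 →L[ℂ] 𝒜
  lsmul_add : ∀ α β, lsmul (α + β) = lsmul α + lsmul β
  lsmul_smulc : ∀ (z : ℂ) α, lsmul (z • α) = z • lsmul α
  rsmul_add : ∀ α β, rsmul (α + β) = rsmul α + rsmul β
  rsmul_smulc : ∀ (z : ℂ) α, rsmul (z • α) = z • rsmul α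
  lsmul_bound : ∃ C : ℝ, ∀ α, ‖lsmul α‖ ≤ C * ‖α‖
  rsmul_bound : ∃ C : ℝ, ∀ α, ‖rsmul α‖ ≤ C * ‖α‖
  lsmul_mulA : ∀ α β a, lsmul (α * β) a = lsmul α (lsmul β a)
  rsmul_mulA : ∀ α β a, rsmul (α * β) a = rsmul β (rsmul α a)
  lsmul_rsmul : ∀ α β a, rsmul β (lsmul α a) = lsmul α (rsmul β a)
  lsmul_compat : ∀ α a b, lsmul α (a * b) = lsmul α a * b
  rsmul_compat : ∀ α a b, rsmul α (a * b) = a * rsmul α b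

/-- The full setting of the paper: `𝒜` is a Banach algebra with compatible `𝔄`-actions,
`T = 𝒜 ⊗̂ 𝒜` is its projective tensor square carrying the induced `𝔄`-actions
(`tlsmul α (a ⊗ b) = (α·a) ⊗ b`, `trsmul α (a ⊗ b) = a ⊗ (b·α)`), `I ⊆ T` is the closed
ideal generated by the elements `α·a ⊗ b - a ⊗ b·α`, `J ⊆ 𝒜` is the closed ideal generated
by `ω(I)`, and the induced bounded operators on the quotient Banach spaces
`T ⧸ I = 𝒜 ⊗̂_𝔄 𝒜` and `𝒜 ⧸ J` are recorded: `qω` is the induced multiplication map `ω̃`,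
`qlsmul/qrsmul` (resp. `qtlsmul/qtrsmul`) are the induced `𝔄`-actions on `𝒜 ⧸ J`
(resp. `T ⧸ I`), and `qmulL/qmulR` (resp. `qlmul/qrmul`) are the induced `𝒜`- (hence
`𝒜/J`-) bimodule actions on `𝒜 ⧸ J` (resp. `T ⧸ I`). -/
structure ModuleSetting (𝔄 : Type u₁) (𝒜 : Type u) (T : Type v)
    [NonUnitalNormedRing 𝔄] [NormedSpace ℂ 𝔄] [CompleteSpace 𝔄]
    [NonUnitalNormedRing 𝒜] [NormedSpace ℂ 𝒜] [CompleteSpace 𝒜]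
    [NonUnitalNormedRing T] [NormedSpace ℂ T] [CompleteSpace T] extends
    TensorSquareSetting 𝒜 T, ActionSetting 𝔄 𝒜 where
  tlsmul : 𝔄 → T →L[ℂ] T
  trsmul : 𝔄 → T →L[ℂ] T
  tlsmul_tp : ∀ α a b, tlsmul α (tp a b) = tp (lsmul α a) b
  trsmul_tp : ∀ α a b, trsmul α (tp a b) = tp a (rsmul α b)
  I : Submodule ℂ T
  J : Submodule ℂ 𝒜
  hI : I = closedIdealGen
    {x : T | ∃ (α : 𝔄) (a b : 𝒜), x = tlsmul α (tp a b) - trsmul α (tp a b)}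
  hJ : J = closedIdealGen (ω '' I)
  qω : (T ⧸ I) →L[ℂ] (𝒜 ⧸ J)
  qω_mk : ∀ t, qω (Submodule.Quotient.mk t) = Submodule.Quotient.mk (ω t)
  qlsmul : 𝔄 → (𝒜 ⧸ J) →L[ℂ] (𝒜 ⧸ J)
  qrsmul : 𝔄 → (𝒜 ⧸ J) →L[ℂ] (𝒜 ⧸ J)
  qlsmul_mk : ∀ α a, qlsmul α (Submodule.Quotient.mk a) = Submodule.Quotient.mk (lsmul α a)
  qrsmul_mk : ∀ α a, qrsmul α (Submodule.Quotient.mk a) = Submodule.Quotient.mk (rsmul α a)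
  qmulL : 𝒜 → (𝒜 ⧸ J) →L[ℂ] (𝒜 ⧸ J)
  qmulR : 𝒜 → (𝒜 ⧸ J) →L[ℂ] (𝒜 ⧸ J)
  qmulL_mk : ∀ a b, qmulL a (Submodule.Quotient.mk b) = Submodule.Quotient.mk (a * b)
  qmulR_mk : ∀ a b, qmulR a (Submodule.Quotient.mk b) = Submodule.Quotient.mk (b * a)
  qtlsmul : 𝔄 → (T ⧸ I) →L[ℂ] (T ⧸ I)
  qtrsmul : 𝔄 → (T ⧸ I) →L[ℂ] (T ⧸ I)
  qtlsmul_mk : ∀ α t, qtlsmul α (Submodule.Quotient.mk t) = Submodule.Quotient.mk (tlsmul α t)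
  qtrsmul_mk : ∀ α t, qtrsmul α (Submodule.Quotient.mk t) = Submodule.Quotient.mk (trsmul α t)
  qlmul : 𝒜 → (T ⧸ I) →L[ℂ] (T ⧸ I)
  qrmul : 𝒜 → (T ⧸ I) →L[ℂ] (T ⧸ I)
  qlmul_mk : ∀ a t, qlmul a (Submodule.Quotient.mk t) = Submodule.Quotient.mk (lmul a t)
  qrmul_mk : ∀ a t, qrmul a (Submodule.Quotient.mk t) = Submodule.Quotient.mk (rmul a t)

namespace ModuleSetting

variable {𝔄 : Type u₁} {𝒜 : Type u} {T : Type v}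
    [NonUnitalNormedRing 𝔄] [NormedSpace ℂ 𝔄] [CompleteSpace 𝔄]
    [NonUnitalNormedRing 𝒜] [NormedSpace ℂ 𝒜] [CompleteSpace 𝒜]
    [NonUnitalNormedRing T] [NormedSpace ℂ T] [CompleteSpace T]

/-- `𝒜` is module biprojective (as an `𝔄`-module) if the induced multiplication map
`ω̃ : 𝒜 ⊗̂_𝔄 𝒜 → 𝒜 ⧸ J` has a bounded right inverse which is an `𝒜/J`-`𝔄`-module morphism
(a bounded additive map commuting with the `𝔄`-actions and the `𝒜/J`-bimodule actions). -/
def ModuleBiprojective (S : ModuleSetting 𝔄 𝒜 T) : Prop :=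
  ∃ ρ : (𝒜 ⧸ S.J) → (T ⧸ S.I),
    (∀ x y, ρ (x + y) = ρ x + ρ y) ∧
    (∃ C : ℝ, ∀ x, ‖ρ x‖ ≤ C * ‖x‖) ∧
    (∀ α x, ρ (S.qlsmul α x) = S.qtlsmul α (ρ x)) ∧
    (∀ α x, ρ (S.qrsmul α x) = S.qtrsmul α (ρ x)) ∧
    (∀ a x, ρ (S.qmulL a x) = S.qlmul a (ρ x)) ∧
    (∀ a x, ρ (S.qmulR a x) = S.qrmul a (ρ x)) ∧
    (∀ x, S.qω (ρ x) = x)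

/-- `𝒜` is module biflat (as an `𝔄`-module) if the adjoint
`ω̃* : (𝒜 ⧸ J)* → (𝒜 ⊗̂_𝔄 𝒜)*` has a bounded left inverse which is an `𝒜/J`-`𝔄`-module
morphism (for the dual actions). -/
def ModuleBiflat (S : ModuleSetting 𝔄 𝒜 T) : Prop :=
  ∃ θ : ((T ⧸ S.I) →L[ℂ] ℂ) → ((𝒜 ⧸ S.J) →L[ℂ] ℂ),
    (∀ f g, θ (f + g) = θ f + θ g) ∧
    (∃ C : ℝ, ∀ f, ‖θ f‖ ≤ C * ‖f‖) ∧
    (∀ α f, θ (f.comp (S.qtrsmul α)) = (θ f).comp (S.qrsmul α)) ∧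
    (∀ α f, θ (f.comp (S.qtlsmul α)) = (θ f).comp (S.qlsmul α)) ∧
    (∀ a f, θ (f.comp (S.qrmul a)) = (θ f).comp (S.qmulR a)) ∧
    (∀ a f, θ (f.comp (S.qlmul a)) = (θ f).comp (S.qmulL a)) ∧
    (∀ g : (𝒜 ⧸ S.J) →L[ℂ] ℂ, θ (g.comp S.qω) = g)

/-- `𝔄` acts trivially on `𝒜` from the left, via the continuous functional `f`:
`α · a = f(α) a`. -/
def TrivialLeftAction (S : ModuleSetting 𝔄 𝒜 T) (f : 𝔄 →L[ℂ] ℂ) : Prop :=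
  ∀ α a, S.lsmul α a = f α • a

/-- The quotient algebra `𝒜 ⧸ J` has a left identity `e + J`. -/
def HasLeftIdentity (S : ModuleSetting 𝔄 𝒜 T) : Prop :=
  ∃ e : 𝒜, ∀ x : 𝒜 ⧸ S.J, S.qmulL e x = x

/-- The quotient algebra `𝒜 ⧸ J` has an identity `e + J`. -/
def HasIdentity (S : ModuleSetting 𝔄 𝒜 T) : Prop :=
  ∃ e : 𝒜, ∀ x : 𝒜 ⧸ S.J, S.qmulL e x = x ∧ S.qmulR e x = x

/-- `𝔄` has a bounded approximate identity for `𝒜`: a bounded net `(α_j)` in `𝔄` with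
`‖α_j · a - a‖ → 0` and `‖a · α_j - a‖ → 0` for every `a ∈ 𝒜`. -/
def HasBoundedApproximateIdentityFor (S : ModuleSetting 𝔄 𝒜 T) : Prop :=
  ∃ C : ℝ, 0 < C ∧ ∀ ε : ℝ, 0 < ε → ∀ F : Finset 𝒜, ∃ α : 𝔄, ‖α‖ ≤ C ∧
    ∀ a ∈ F, ‖S.lsmul α a - a‖ < ε ∧ ‖S.rsmul α a - a‖ < ε

/-- The quotient algebra `𝒜 ⧸ J` has a bounded approximate identity. -/
def QuotientHasBoundedApproximateIdentity (S : ModuleSetting 𝔄 𝒜 T) : Prop :=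
  ∃ C : ℝ, 0 < C ∧ ∀ ε : ℝ, 0 < ε → ∀ F : Finset (𝒜 ⧸ S.J), ∃ e : 𝒜,
    ‖(Submodule.Quotient.mk e : 𝒜 ⧸ S.J)‖ ≤ C ∧
    ∀ x ∈ F, ‖S.qmulL e x - x‖ < ε ∧ ‖S.qmulR e x - x‖ < ε

/-- `𝒜 ⧸ J` is a commutative `𝔄`-module. -/
def QuotientCommutative (S : ModuleSetting 𝔄 𝒜 T) : Prop :=
  ∀ (α : 𝔄) (x : 𝒜 ⧸ S.J), S.qlsmul α x = S.qrsmul α x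

end ModuleSetting

variable {𝔄 : Type u₁} {𝒜 : Type u} {T : Type v}
  [NonUnitalNormedRing 𝔄] [NormedSpace ℂ 𝔄] [CompleteSpace 𝔄]
  [NonUnitalNormedRing 𝒜] [NormedSpace ℂ 𝒜] [CompleteSpace 𝒜]
  [NonUnitalNormedRing T] [NormedSpace ℂ T] [CompleteSpace T]

theorem subset_closedIdealGen {R : Type u} [NonUnitalNormedRing R] [NormedSpace ℂ R]
    (s : Set R) : s ⊆ (closedIdealGen s : Set R) := by
  intro x hx
  exact Submodule.mem_sInf.mpr fun _ hp => hp.1 hx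

/-- Lemma 2.3 / `[abe, Lemma 3.1]`.
Let `𝔄` act trivially on `𝒜` from the left via the continuous functional `f`, and let `J₀` be
a closed (two-sided) ideal of `𝒜` containing `J`.  If `𝒜 ⧸ J₀` has a left identity `e + J₀`
(equivalently `e * a - a ∈ J₀` for every `a`), then `a · α - f(α) a ∈ J₀` for every `α ∈ 𝔄`
and every `a ∈ 𝒜`. -/
theorem stmt0 (S : ModuleSetting 𝔄 𝒜 T) (f : 𝔄 →L[ℂ] ℂ)
    (hf : S.TrivialLeftAction f)
    (J₀ : Submodule ℂ 𝒜) (hJ₀closed : IsClosed (J₀ : Set 𝒜))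
    (hJ₀ideal : ∀ x ∈ J₀, ∀ y : 𝒜, x * y ∈ J₀ ∧ y * x ∈ J₀)
    (hJJ₀ : S.J ≤ J₀)
    (e : 𝒜) (he : ∀ a : 𝒜, e * a - a ∈ J₀) :
    ∀ (α : 𝔄) (a : 𝒜), S.rsmul α a - f α • a ∈ J₀ := by
  intro α a
  have hJ : S.ω (S.tlsmul α (S.tp e a) - S.trsmul α (S.tp e a)) ∈ S.J := by
    rw [S.hJ]
    refine subset_closedIdealGen _ (Set.mem_image_of_mem _ ?_)
    rw [S.hI]
    exact subset_closedIdealGen _ ⟨α, e, a, rfl⟩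
  have h : f α • (e * a) - e * S.rsmul α a ∈ J₀ := by
    apply hJJ₀
    rwa [S.tlsmul_tp, S.trsmul_tp, map_sub, S.ω_tp, S.ω_tp, ← S.lsmul_compat, hf] at hJ
  convert J₀.sub_mem (J₀.sub_mem (J₀.smul_mem (f α) (he a)) h) (he (S.rsmul α a)) using 1
  rw [smul_sub]
  abel
end
end

section
/- Assume 𝔄 acts trivially on 𝒜 from the left, 𝒜/J has a left identity, and 𝔄 has a bounded approximate identity for 𝒜. If 𝒜 is module biprojective as an 𝔄-module, then the quotient Banach algebra 𝒜/J is biprojective. -/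
noncomputable section

open scoped Topology

universe u u₁ u₂ u₃ v w

/-- `p : 𝒜 → B` exhibits the Banach algebra `B` as the quotient Banach algebra `𝒜 ⧸ J`:
it is a surjective multiplicative bounded linear map with kernel `J` which identifies the
norm of `B` with the quotient norm of `𝒜 ⧸ J`. -/
structure IsQuotientBanachAlgebraOf {𝒜 : Type u} (B : Type u₂)
    [NonUnitalNormedRing 𝒜] [NormedSpace ℂ 𝒜] [CompleteSpace 𝒜]
    [NonUnitalNormedRing B] [NormedSpace ℂ B] [CompleteSpace B]
    (J : Submodule ℂ 𝒜) (p : 𝒜 → B) : Prop where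
  map_add : ∀ a b, p (a + b) = p a + p b
  map_smul : ∀ (z : ℂ) (a : 𝒜), p (z • a) = z • p a
  map_mul : ∀ a b, p (a * b) = p a * p b
  surjective : Function.Surjective p
  ker : ∀ a, p a = 0 ↔ a ∈ J
  norm_eq : ∀ a, ‖p a‖ = ‖(Submodule.Quotient.mk a : 𝒜 ⧸ J)‖

variable {𝔄 : Type u₁} {𝒜 : Type u} {T : Type v}
  [NonUnitalNormedRing 𝔄] [NormedSpace ℂ 𝔄] [CompleteSpace 𝔄]
  [NonUnitalNormedRing 𝒜] [NormedSpace ℂ 𝒜] [CompleteSpace 𝒜]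
  [NonUnitalNormedRing T] [NormedSpace ℂ T] [CompleteSpace T]

namespace TensorSquareSetting

theorem closed_induction {B : Type u₂} {TB : Type u₃}
    [NonUnitalNormedRing B] [NormedSpace ℂ B] [CompleteSpace B]
    [NonUnitalNormedRing TB] [NormedSpace ℂ TB] [CompleteSpace TB]
    (ts : TensorSquareSetting B TB) {C : TB → Prop} (hclosed : IsClosed {x | C x})
    (htp : ∀ a b, C (ts.tp a b)) (hadd : ∀ x y, C x → C y → C (x + y)) (x : TB) : C x := by
  refine ts.tp_dense.induction (P := C) (fun y hy => ?_) hclosed x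
  suffices h : ∀ z : ℂ, C (z • y) by simpa using h 1
  induction hy using Submodule.span_induction with
  | mem y hy =>
    obtain ⟨⟨a, b⟩, rfl⟩ := hy
    intro z
    simpa only [ts.tp_smul_left] using htp (z • a) b
  | zero =>
    intro z
    have h0 : ts.tp 0 0 = 0 := by simpa using ts.tp_smul_left 0 0 0
    simpa [h0] using htp 0 0
  | add y₁ y₂ _ _ h₁ h₂ =>
    intro z
    simpa only [smul_add] using hadd _ _ (h₁ z) (h₂ z)
  | smul c y _ h =>
    intro z
    simpa only [smul_smul] using h (z * c)

theorem denseRange_linearCombination {B : Type u₂} {TB : Type u₃}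
    [NonUnitalNormedRing B] [NormedSpace ℂ B] [CompleteSpace B]
    [NonUnitalNormedRing TB] [NormedSpace ℂ TB] [CompleteSpace TB]
    (ts : TensorSquareSetting B TB) :
    DenseRange (Finsupp.linearCombination ℂ fun q : B × B => ts.tp q.1 q.2) := by
  have h := ts.tp_dense
  rwa [← Finsupp.range_linearCombination, LinearMap.coe_range] at h

/-- The universal property for target spaces in an arbitrary universe: by duality it follows from
the one for one-dimensional target spaces. -/
theorem exists_lift {B : Type u₂} {TB : Type u₃} {X : Type v}
    [NonUnitalNormedRing B] [NormedSpace ℂ B] [CompleteSpace B]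
    [NonUnitalNormedRing TB] [NormedSpace ℂ TB] [CompleteSpace TB]
    [NormedAddCommGroup X] [NormedSpace ℂ X] [CompleteSpace X]
    (ts : TensorSquareSetting.{u₂, u₃, w} B TB) (φ : B →L[ℂ] B →L[ℂ] X) :
    ∃ ψ : TB →L[ℂ] X, ∀ a b, ψ (ts.tp a b) = φ a b := by
  let e := Finsupp.linearCombination ℂ fun q : B × B => ts.tp q.1 q.2
  let F := Finsupp.linearCombination ℂ fun q : B × B => φ q.1 q.2
  have hbound : ∀ l, ‖F l‖ ≤ ‖φ‖ * ‖e l‖ := by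
    intro l
    refine NormedSpace.norm_le_dual_bound ℂ _ (by positivity) fun g => ?_
    let up : ℂ ≃ₗᵢ[ℂ] ULift.{w} ℂ := (LinearIsometryEquiv.ulift ℂ ℂ).symm
    let g' : X →L[ℂ] ULift.{w} ℂ := (up : ℂ →L[ℂ] ULift.{w} ℂ).comp g
    have hg' : ∀ x, ‖g' x‖ = ‖g x‖ := fun x => up.norm_map (g x)
    obtain ⟨ψ, hψ, hψtp⟩ := ts.tp_universal ((ContinuousLinearMap.compL ℂ B X _ g').comp φ)
    have hψF : ψ (e l) = g' (F l) := by
      simp only [e, F, Finsupp.linearCombination_apply, Finsupp.sum, map_sum, map_smul, hψtp]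
      rfl
    have hnorm : ‖ψ‖ ≤ ‖g‖ * ‖φ‖ := by
      refine hψ.trans (ContinuousLinearMap.opNorm_le_bound _ (by positivity) fun a => ?_)
      refine ContinuousLinearMap.opNorm_le_bound _ (by positivity) fun b => ?_
      calc ‖g' (φ a b)‖ = ‖g (φ a b)‖ := hg' _
        _ ≤ ‖g‖ * ‖φ a b‖ := g.le_opNorm _
        _ ≤ ‖g‖ * (‖φ‖ * ‖a‖ * ‖b‖) := by gcongr; exact φ.le_opNorm₂ a b
        _ = ‖g‖ * ‖φ‖ * ‖a‖ * ‖b‖ := by ring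
    calc ‖g (F l)‖ = ‖ψ (e l)‖ := by rw [hψF, hg']
      _ ≤ ‖ψ‖ * ‖e l‖ := ψ.le_opNorm _
      _ ≤ ‖g‖ * ‖φ‖ * ‖e l‖ := by gcongr
      _ = ‖φ‖ * ‖e l‖ * ‖g‖ := by ring
  refine ⟨F.extendOfNorm e, fun a b => ?_⟩
  have h := LinearMap.extendOfNorm_eq ts.denseRange_linearCombination ⟨_, hbound⟩
    (Finsupp.single (a, b) 1)
  simpa [e, F] using h

/-- A bounded linear map between Banach algebras induces a bounded linear map between their
projective tensor squares. -/
theorem exists_map {A : Type u₁} {TA : Type u} {B : Type u₂} {TB : Type u₃}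
    [NonUnitalNormedRing A] [NormedSpace ℂ A] [CompleteSpace A]
    [NonUnitalNormedRing TA] [NormedSpace ℂ TA] [CompleteSpace TA]
    [NonUnitalNormedRing B] [NormedSpace ℂ B] [CompleteSpace B]
    [NonUnitalNormedRing TB] [NormedSpace ℂ TB] [CompleteSpace TB]
    (tsA : TensorSquareSetting A TA) (tsB : TensorSquareSetting B TB) (p : A →L[ℂ] B) :
    ∃ P : TA →L[ℂ] TB, ∀ a b, P (tsA.tp a b) = tsB.tp (p a) (p b) := by
  let β : B →L[ℂ] B →L[ℂ] TB :=
    (LinearMap.mk₂ ℂ tsB.tp tsB.tp_add_left tsB.tp_smul_left tsB.tp_add_right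
      tsB.tp_smul_right).mkContinuous₂ 1 fun a b => by simpa using tsB.tp_norm a b
  obtain ⟨P, hP⟩ := tsA.exists_lift (β.bilinearComp p p)
  exact ⟨P, hP⟩

theorem map_mul_of_map_tp {A : Type u₁} {TA : Type u} {B : Type u₂} {TB : Type u₃}
    [NonUnitalNormedRing A] [NormedSpace ℂ A] [CompleteSpace A]
    [NonUnitalNormedRing TA] [NormedSpace ℂ TA] [CompleteSpace TA]
    [NonUnitalNormedRing B] [NormedSpace ℂ B] [CompleteSpace B]
    [NonUnitalNormedRing TB] [NormedSpace ℂ TB] [CompleteSpace TB]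
    (tsA : TensorSquareSetting A TA) (tsB : TensorSquareSetting B TB) {p : A → B}
    (hp : ∀ a b, p (a * b) = p a * p b) {P : TA →L[ℂ] TB}
    (hP : ∀ a b, P (tsA.tp a b) = tsB.tp (p a) (p b)) (x y : TA) :
    P (x * y) = P x * P y := by
  refine tsA.closed_induction (C := fun x => P (x * y) = P x * P y)
    (isClosed_eq (by fun_prop) (by fun_prop)) (fun a b => ?_) (fun x₁ x₂ h₁ h₂ => ?_) x
  · refine tsA.closed_induction (C := fun y => P (tsA.tp a b * y) = P (tsA.tp a b) * P y)
      (isClosed_eq (by fun_prop) (by fun_prop)) (fun c d => ?_) (fun y₁ y₂ h₁ h₂ => ?_) y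
    · simp only [hP, hp, tsA.tp_mul, tsB.tp_mul]
    · simp only [mul_add, map_add, h₁, h₂]
  · simp only [add_mul, map_add, h₁, h₂]

end TensorSquareSetting

theorem closedIdealGen_le_ker {R : Type u} {R' : Type v}
    [NonUnitalNormedRing R] [NormedSpace ℂ R] [NonUnitalNormedRing R'] [NormedSpace ℂ R']
    {s : Set R} {P : R →L[ℂ] R'} (hmul : ∀ x y, P (x * y) = P x * P y)
    (hs : ∀ x ∈ s, P x = 0) : closedIdealGen s ≤ P.ker := by
  refine sInf_le ⟨fun x hx => hs x hx, P.isClosed_ker, fun x hx y => ?_⟩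
  have hx' : P x = 0 := hx
  exact ⟨show P (x * y) = 0 by simp [hmul, hx'], show P (y * x) = 0 by simp [hmul, hx']⟩

namespace IsQuotientBanachAlgebraOf

/-- The quotient map onto a realization of a quotient Banach algebra, as a bounded linear map. -/
def toContinuousLinearMap {B : Type u₂} [NonUnitalNormedRing B] [NormedSpace ℂ B]
    [CompleteSpace B] {J : Submodule ℂ 𝒜} {p : 𝒜 → B} (hp : IsQuotientBanachAlgebraOf B J p) :
    𝒜 →L[ℂ] B :=
  LinearMap.mkContinuous { toFun := p, map_add' := hp.map_add, map_smul' := hp.map_smul } 1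
    fun a => by
      rw [one_mul]
      exact (hp.norm_eq a).trans_le (Submodule.Quotient.norm_mk_le J a)

theorem exists_inverse {B : Type u₂} [NonUnitalNormedRing B] [NormedSpace ℂ B]
    [CompleteSpace B] {J : Submodule ℂ 𝒜} {p : 𝒜 → B} (hp : IsQuotientBanachAlgebraOf B J p) :
    ∃ q : B →ₗ[ℂ] 𝒜 ⧸ J, (∀ a, q (p a) = Submodule.Quotient.mk a) ∧ ∀ b, ‖q b‖ = ‖b‖ := by
  have hq : ∀ a, (Submodule.Quotient.mk (Function.surjInv hp.surjective (p a)) : 𝒜 ⧸ J) =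
      Submodule.Quotient.mk a := fun a => by
    rw [Submodule.Quotient.eq, ← hp.ker]
    have h := hp.toContinuousLinearMap.map_sub (Function.surjInv hp.surjective (p a)) a
    exact h.trans (sub_eq_zero.2 (Function.surjInv_eq hp.surjective (p a)))
  refine ⟨{ toFun := fun b => Submodule.Quotient.mk (Function.surjInv hp.surjective b)
            map_add' := fun x y => ?_
            map_smul' := fun z x => ?_ }, hq, fun b => ?_⟩
  · obtain ⟨a, rfl⟩ := hp.surjective x
    obtain ⟨b, rfl⟩ := hp.surjective y
    rw [← hp.map_add, hq, hq, hq, Submodule.Quotient.mk_add]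
  · obtain ⟨a, rfl⟩ := hp.surjective x
    rw [← hp.map_smul, hq, hq, Submodule.Quotient.mk_smul, RingHom.id_apply]
  · obtain ⟨a, rfl⟩ := hp.surjective b
    exact (congrArg norm (hq a)).trans (hp.norm_eq a).symm

end IsQuotientBanachAlgebraOf

namespace ModuleSetting

theorem tlsmul_eq_smul {S : ModuleSetting 𝔄 𝒜 T} {f : 𝔄 →L[ℂ] ℂ} (hf : S.TrivialLeftAction f)
    (α : 𝔄) (t : T) : S.tlsmul α t = f α • t := by
  refine S.closed_induction (C := fun t => S.tlsmul α t = f α • t)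
    (isClosed_eq (by fun_prop) (by fun_prop)) (fun a b => ?_) (fun x y hx hy => ?_) t
  · rw [S.tlsmul_tp, hf, S.tp_smul_left]
  · rw [map_add, hx, hy, smul_add]

theorem smul_sub_rsmul_mem {S : ModuleSetting 𝔄 𝒜 T} {f : 𝔄 →L[ℂ] ℂ}
    (hf : S.TrivialLeftAction f) (hid : S.HasLeftIdentity) (α : 𝔄) (b : 𝒜) :
    f α • b - S.rsmul α b ∈ S.J := by
  obtain ⟨e, he⟩ := hid
  have hI : S.tlsmul α (S.tp e b) - S.trsmul α (S.tp e b) ∈ S.I := by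
    rw [S.hI]
    exact subset_closedIdealGen _ ⟨α, e, b, rfl⟩
  have hJ : S.ω (S.tlsmul α (S.tp e b) - S.trsmul α (S.tp e b)) ∈ S.J := by
    rw [S.hJ]
    exact subset_closedIdealGen _ ⟨_, hI, rfl⟩
  have hω : S.ω (S.tlsmul α (S.tp e b) - S.trsmul α (S.tp e b)) =
      e * (f α • b - S.rsmul α b) := by
    rw [tlsmul_eq_smul hf, S.trsmul_tp, ← S.tp_smul_right, map_sub, S.ω_tp, S.ω_tp, mul_sub]
  rw [hω, ← Submodule.Quotient.mk_eq_zero, ← S.qmulL_mk, he] at hJ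
  exact (Submodule.Quotient.mk_eq_zero _).1 hJ

theorem subsingleton_of_trivialLeftAction_zero {S : ModuleSetting 𝔄 𝒜 T} {f : 𝔄 →L[ℂ] ℂ}
    (hf : S.TrivialLeftAction f) (hbai : S.HasBoundedApproximateIdentityFor)
    (h0 : ∀ α, f α = 0) (a : 𝒜) : a = 0 := by
  obtain ⟨C, -, h⟩ := hbai
  refine norm_le_zero_iff.1 (le_of_forall_pos_le_add fun ε hε => ?_)
  obtain ⟨α, -, hα⟩ := h ε hε {a}
  have := (hα a (Finset.mem_singleton_self a)).1
  rw [hf, h0, zero_smul, zero_sub, norm_neg] at this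
  linarith

/-- If `𝔄` acts trivially from the left, then additive maps commuting with the left `𝔄`-actions
are automatically `ℂ`-linear. -/
theorem map_smul_of_map_qlsmul {S : ModuleSetting 𝔄 𝒜 T} {f : 𝔄 →L[ℂ] ℂ}
    (hf : S.TrivialLeftAction f) (hbai : S.HasBoundedApproximateIdentityFor)
    {ρ : (𝒜 ⧸ S.J) → (T ⧸ S.I)} (hadd : ∀ x y, ρ (x + y) = ρ x + ρ y)
    (hρ : ∀ α x, ρ (S.qlsmul α x) = S.qtlsmul α (ρ x)) (z : ℂ) (x : 𝒜 ⧸ S.J) :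
    ρ (z • x) = z • ρ x := by
  by_cases h : ∀ α, f α = 0
  · obtain ⟨a, rfl⟩ := Submodule.Quotient.mk_surjective _ x
    have hρ0 : ρ 0 = 0 := by simpa using hadd 0 0
    rw [subsingleton_of_trivialLeftAction_zero hf hbai h a, Submodule.Quotient.mk_zero, smul_zero,
      hρ0, smul_zero]
  · push Not at h
    obtain ⟨α, hα⟩ := h
    obtain ⟨β, hβ⟩ : ∃ β, f β = z := ⟨(z / f α) • α, by simp [hα]⟩
    have hl : ∀ x, S.qlsmul β x = z • x := fun x => by
      obtain ⟨a, rfl⟩ := Submodule.Quotient.mk_surjective _ x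
      rw [S.qlsmul_mk, hf, hβ, Submodule.Quotient.mk_smul]
    have hr : ∀ t, S.qtlsmul β t = z • t := fun t => by
      obtain ⟨t, rfl⟩ := Submodule.Quotient.mk_surjective _ t
      rw [S.qtlsmul_mk, tlsmul_eq_smul hf, hβ, Submodule.Quotient.mk_smul]
    rw [← hl, hρ, hr]

end ModuleSetting

/-- Proposition 2.6.
Assume `𝔄` acts trivially on `𝒜` from the left, `𝒜 ⧸ J` has a left identity, and `𝔄` has a
bounded approximate identity for `𝒜`.  If `𝒜` is module biprojective, then the quotient
Banach algebra `𝒜 ⧸ J` (realized as the Banach algebra `B`) is biprojective. -/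
theorem stmt3 {B : Type u₂} {TB : Type u₃}
    [NonUnitalNormedRing B] [NormedSpace ℂ B] [CompleteSpace B]
    [NonUnitalNormedRing TB] [NormedSpace ℂ TB] [CompleteSpace TB]
    (S : ModuleSetting 𝔄 𝒜 T) (f : 𝔄 →L[ℂ] ℂ)
    (hf : S.TrivialLeftAction f)
    (hid : S.HasLeftIdentity)
    (hbai : S.HasBoundedApproximateIdentityFor)
    (p : 𝒜 → B) (hp : IsQuotientBanachAlgebraOf B S.J p)
    (tsB : TensorSquareSetting B TB)
    (hmod : S.ModuleBiprojective) :
    tsB.Biprojective := by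
  obtain ⟨ρ, hadd, ⟨C, hC⟩, hl, -, hL, hR, hω⟩ := hmod
  obtain ⟨q, hq, hqn⟩ := hp.exists_inverse
  obtain ⟨P, hP⟩ : ∃ P : T →L[ℂ] TB, ∀ a b, P (S.tp a b) = tsB.tp (p a) (p b) :=
    S.exists_map tsB hp.toContinuousLinearMap
  have hpsub : ∀ a b, p (a - b) = p a - p b := hp.toContinuousLinearMap.map_sub
  have hker : S.I ≤ P.ker := by
    rw [S.hI]
    refine closedIdealGen_le_ker (S.map_mul_of_map_tp tsB hp.map_mul hP) ?_
    rintro _ ⟨α, a, b, rfl⟩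
    have h := (hp.ker _).2 (ModuleSetting.smul_sub_rsmul_mem hf hid α b)
    rw [hpsub, sub_eq_zero] at h
    rw [ModuleSetting.tlsmul_eq_smul hf, S.trsmul_tp, ← S.tp_smul_right, map_sub, hP, hP, h,
      sub_self]
  let Q : (T ⧸ S.I) →L[ℂ] TB := S.I.liftQL P hker
  have hQ : ∀ t, Q (Submodule.Quotient.mk t) = P t := fun _ => rfl
  have hQL : ∀ a t, Q (S.qlmul a t) = tsB.lmul (p a) (Q t) := by
    intro a t
    obtain ⟨t, rfl⟩ := Submodule.Quotient.mk_surjective _ t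
    rw [S.qlmul_mk, hQ, hQ]
    refine S.closed_induction (C := fun t => P (S.lmul a t) = tsB.lmul (p a) (P t))
      (isClosed_eq (by fun_prop) (by fun_prop)) (fun b c => ?_) (fun x y hx hy => ?_) t
    · rw [S.lmul_tp, hP, hP, tsB.lmul_tp, hp.map_mul]
    · simp only [map_add, hx, hy]
  have hQR : ∀ a t, Q (S.qrmul a t) = tsB.rmul (p a) (Q t) := by
    intro a t
    obtain ⟨t, rfl⟩ := Submodule.Quotient.mk_surjective _ t
    rw [S.qrmul_mk, hQ, hQ]
    refine S.closed_induction (C := fun t => P (S.rmul a t) = tsB.rmul (p a) (P t))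
      (isClosed_eq (by fun_prop) (by fun_prop)) (fun b c => ?_) (fun x y hx hy => ?_) t
    · rw [S.rmul_tp, hP, hP, tsB.rmul_tp, hp.map_mul]
    · simp only [map_add, hx, hy]
  have hpc : Continuous p := hp.toContinuousLinearMap.continuous
  have hQω : ∀ t, q (tsB.ω (Q t)) = S.qω t := by
    intro t
    obtain ⟨t, rfl⟩ := Submodule.Quotient.mk_surjective _ t
    rw [S.qω_mk, hQ, ← hq]
    congr 1
    refine S.closed_induction (C := fun t => tsB.ω (P t) = p (S.ω t))
      (isClosed_eq (by fun_prop) (by fun_prop)) (fun b c => ?_) (fun x y hx hy => ?_) t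
    · rw [hP, tsB.ω_tp, S.ω_tp, hp.map_mul]
    · simp only [map_add, hp.map_add, hx, hy]
  let ρ' : (𝒜 ⧸ S.J) →ₗ[ℂ] (T ⧸ S.I) :=
    { toFun := ρ
      map_add' := hadd
      map_smul' := ModuleSetting.map_smul_of_map_qlsmul hf hbai hadd hl }
  let σ : B →L[ℂ] (T ⧸ S.I) :=
    (ρ'.comp q).mkContinuous C fun b => (hC (q b)).trans_eq (by rw [hqn])
  have hσ : ∀ b, (Q.comp σ) b = Q (ρ (q b)) := fun _ => rfl
  refine ⟨Q.comp σ, fun a b => ?_, fun a b => ?_, fun b => ?_⟩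
  · obtain ⟨a, rfl⟩ := hp.surjective a
    obtain ⟨b, rfl⟩ := hp.surjective b
    rw [hσ, hσ, ← hp.map_mul, hq, hq, ← S.qmulL_mk, hL, hQL]
  · obtain ⟨a, rfl⟩ := hp.surjective a
    obtain ⟨b, rfl⟩ := hp.surjective b
    rw [hσ, hσ, ← hp.map_mul, hq, hq, ← S.qmulR_mk, hR, hQR]
  · rw [hσ, ← sub_eq_zero, ← norm_eq_zero, ← hqn, map_sub, hQω, hω, sub_self, norm_zero]
end
end
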